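/- (Upper bound on cost difference, Proposition 3 of the paper.) Let T ≥ 1 be an integer, Γ ≥ 1 and σ ≥ 0 reals. Let ε : ℕ → ℝ be nonnegative and nondecreasing, and define F(T) = Σ_{τ=0}^{T−1} ε(τ). Let A_p, D_p, A_*, D_* : {1,2,3,…} → ℝ be sequences such that: (i) for every t ≥ 1, |A_p(t) − D_p(t)| ≤ ε((t−1) mod T) and |A_*(t) − D_*(t)| ≤ ε((t−1) mod T); and (ii) for every integer n ≥ 0 and every integer m with 1 ≤ m ≤ T, Σ_{t=nT+1}^{nT+m} D_p(t) ≤ Γ · Σ_{t=nT+1}^{nT+m} D_*(t) + σ. Then limsup_{N→∞} (1/N)·(Σ_{t=1}^{N} A_p(t) − Γ·Σ_{t=1}^{N} A_*(t)) ≤ ((Γ+1)·F(T) + σ) / T. -/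

import Mathlib

open Filter

/-- Upper bound on cost difference, Proposition 3: With look-ahead window
size `T ≥ 1`, competitive ratio `Γ ≥ 1`, migration-cost bound `σ ≥ 0`, and nonnegative
nondecreasing prediction-error bound `ε` with `F(T) = Σ_{τ<T} ε τ`, if the actual and
predicted per-slot costs satisfy `|A_p(t) − D_p(t)| ≤ ε((t−1) mod T)` and
`|A_*(t) − D_*(t)| ≤ ε((t−1) mod T)` for all `t ≥ 1`, and within each window
`Σ D_p ≤ Γ·Σ D_* + σ` (for every prefix of the window), then
`limsup_N (1/N)(Σ_{t≤N} A_p(t) − Γ·Σ_{t≤N} A_*(t)) ≤ ((Γ+1)·F(T) + σ)/T`. -/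
theorem stmt_16 (T : ℕ) (hT : 1 ≤ T) (Γ σ : ℝ) (hΓ : 1 ≤ Γ) (hσ : 0 ≤ σ)
    (ε : ℕ → ℝ) (hεnonneg : ∀ τ, 0 ≤ ε τ) (hεmono : Monotone ε)
    (Ap Dp Astar Dstar : ℕ → ℝ)
    (hp : ∀ t : ℕ, 1 ≤ t → |Ap t - Dp t| ≤ ε ((t - 1) % T))
    (hstar : ∀ t : ℕ, 1 ≤ t → |Astar t - Dstar t| ≤ ε ((t - 1) % T))
    (hwindow : ∀ n : ℕ, ∀ m : ℕ, 1 ≤ m → m ≤ T →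
      ∑ t ∈ Finset.Icc (n * T + 1) (n * T + m), Dp t ≤
        Γ * ∑ t ∈ Finset.Icc (n * T + 1) (n * T + m), Dstar t + σ) :
    Filter.limsup
        (fun N : ℕ => (1 / (N : ℝ)) *
          ((∑ t ∈ Finset.Icc 1 N, Ap t) - Γ * ∑ t ∈ Finset.Icc 1 N, Astar t))
        atTop ≤
      ((Γ + 1) * (∑ τ ∈ Finset.range T, ε τ) + σ) / (T : ℝ) := by
  set K : ℝ := (Γ + 1) * (∑ τ ∈ Finset.range T, ε τ) + σ with hK
  have hK0 : 0 ≤ K := by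
    have := Finset.sum_nonneg (fun i (_ : i ∈ Finset.range T) => hεnonneg i)
    positivity
  have hTpos : (0 : ℝ) < T := by exact_mod_cast hT
  have h1 : ∀ n m : ℕ, m ≤ T →
      (∑ t ∈ Finset.Icc (n * T + 1) (n * T + m), Ap t)
        - Γ * ∑ t ∈ Finset.Icc (n * T + 1) (n * T + m), Astar t ≤
      (∑ t ∈ Finset.Icc (n * T + 1) (n * T + m), Dp t)
        - Γ * (∑ t ∈ Finset.Icc (n * T + 1) (n * T + m), Dstar t)
        + (Γ + 1) * ∑ τ ∈ Finset.range m, ε τ := by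
    intro n m
    induction m with
    | zero => intro _; simp
    | succ m ih =>
      intro hm
      have ih := ih (by omega)
      have e : (n * T + (m + 1) - 1) % T = m := by
        have : n * T + (m + 1) - 1 = m + n * T := by omega
        rw [this, Nat.add_mul_mod_self_right, Nat.mod_eq_of_lt (by omega)]
      have a := hp (n * T + (m + 1)) (by omega)
      have b := hstar (n * T + (m + 1)) (by omega)
      rw [e] at a b
      rw [← add_assoc] at a b
      have a' := (abs_le.1 a).2
      have b' := (abs_le.1 b).1
      rw [← add_assoc]
      rw [Finset.sum_Icc_succ_top (by omega), Finset.sum_Icc_succ_top (by omega),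
        Finset.sum_Icc_succ_top (by omega), Finset.sum_Icc_succ_top (by omega),
        Finset.sum_range_succ]
      nlinarith
  have h2 : ∀ n m : ℕ, m ≤ T →
      (∑ t ∈ Finset.Icc (n * T + 1) (n * T + m), Ap t)
        - Γ * ∑ t ∈ Finset.Icc (n * T + 1) (n * T + m), Astar t ≤ K := by
    intro n m hm
    rcases Nat.eq_zero_or_pos m with rfl | hm0
    · simpa using hK0
    · have a := h1 n m hm
      have b := hwindow n m hm0 hm
      have c : ∑ τ ∈ Finset.range m, ε τ ≤ ∑ τ ∈ Finset.range T, ε τ :=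
        Finset.sum_le_sum_of_subset_of_nonneg (Finset.range_mono hm)
          (fun i _ _ => hεnonneg i)
      have d := mul_le_mul_of_nonneg_left c (by linarith : 0 ≤ Γ + 1)
      linarith
  have split : ∀ (f : ℕ → ℝ) (a b : ℕ), ∑ t ∈ Finset.Icc 1 (a + b), f t =
      ∑ t ∈ Finset.Icc 1 a, f t + ∑ t ∈ Finset.Icc (a + 1) (a + b), f t := by
    intro f a b
    induction b with
    | zero => simp
    | succ b ih =>
      rw [← add_assoc, Finset.sum_Icc_succ_top (by omega),
        Finset.sum_Icc_succ_top (by omega), ih, add_assoc]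
  have h3 : ∀ n : ℕ, (∑ t ∈ Finset.Icc 1 (n * T), Ap t)
        - Γ * ∑ t ∈ Finset.Icc 1 (n * T), Astar t ≤ n * K := by
    intro n
    induction n with
    | zero => simp
    | succ n ih =>
      have a := h2 n T le_rfl
      rw [Nat.succ_mul, split Ap, split Astar]
      push_cast
      linarith
  have h4 : ∀ N : ℕ, (∑ t ∈ Finset.Icc 1 N, Ap t)
        - Γ * ∑ t ∈ Finset.Icc 1 N, Astar t ≤ (N : ℝ) * (K / T) + K := by
    intro N
    have a := h2 (N / T) (N % T) (Nat.mod_lt _ hT).le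
    have b := h3 (N / T)
    have e : N / T * T + N % T = N := Nat.div_add_mod' N T
    have s1 := split Ap (N / T * T) (N % T)
    have s2 := split Astar (N / T * T) (N % T)
    rw [e] at s1 s2 a
    have c : ((N / T : ℕ) : ℝ) ≤ (N : ℝ) / T := Nat.cast_div_le
    have d := mul_le_mul_of_nonneg_right c hK0
    have f : (N : ℝ) / T * K = (N : ℝ) * (K / T) := by ring
    rw [s1, s2]
    linarith
  rw [Filter.limsup_eq]
  by_cases hb : BddBelow {a : ℝ | ∀ᶠ N : ℕ in atTop, (1 / (N : ℝ)) *
          ((∑ t ∈ Finset.Icc 1 N, Ap t) - Γ * ∑ t ∈ Finset.Icc 1 N, Astar t) ≤ a}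
  · refine le_of_forall_pos_le_add fun δ hδ => csInf_le hb ?_
    have ht : Tendsto (fun N : ℕ => K / (N : ℝ)) atTop (nhds 0) :=
      tendsto_const_div_atTop_nhds_zero_nat K
    filter_upwards [ht.eventually (gt_mem_nhds hδ), eventually_gt_atTop 0] with N hN hN0
    have hNpos : (0 : ℝ) < N := by exact_mod_cast hN0
    calc _ ≤ (1 / (N : ℝ)) * ((N : ℝ) * (K / T) + K) :=
          mul_le_mul_of_nonneg_left (h4 N) (by positivity)
      _ = K / T + K / N := by field_simp
      _ ≤ K / T + δ := by linarith
  · rw [Real.sInf_of_not_bddBelow hb]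
    positivity
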